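/- arXiv:2001.06111 — 2 statements merged into one kernel-verified Lean document; each statement's English description precedes it below -/
import Mathlib

section
/- Given a bipartite graph G and a priority p on G, the total number of priority-obeyed wedges of G is at most the sum over all edges (u,v) ∈ E(G) of min{deg(u), deg(v)}. -/
/-- A bipartite graph: two disjoint finite vertex layers `U` and `L`,
and an edge set `E ⊆ U × L`. -/
structure BipartiteGraph (V : Type*) [DecidableEq V] where
  U : Finset V
  L : Finset V
  E : Finset (V × V)
  disj : Disjoint U L
  mem_of_edge : ∀ e ∈ E, e.1 ∈ U ∧ e.2 ∈ L

variable {V : Type*} [DecidableEq V]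

namespace BipartiteGraph

/-- The set of neighbors of a vertex. -/
def nbrs (G : BipartiteGraph V) (x : V) : Finset V :=
  ((G.E.filter fun e => e.1 = x).image Prod.snd) ∪
    ((G.E.filter fun e => e.2 = x).image Prod.fst)

/-- The degree of a vertex: its number of neighbors. -/
def deg (G : BipartiteGraph V) (x : V) : ℕ := (G.nbrs x).card

end BipartiteGraph

/-- The butterflies all four of whose edges lie in the edge set `F`: an unordered
pair of first-layer vertices together with an unordered pair of second-layer
vertices, all four cross pairs being edges of `F`. -/
def butterfliesIn (F : Finset (V × V)) : Finset (Finset V × Finset V) :=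
  (((F.image Prod.fst).powersetCard 2) ×ˢ ((F.image Prod.snd).powersetCard 2)).filter
    fun P => ∀ a ∈ P.1, ∀ c ∈ P.2, (a, c) ∈ F

/-- The butterfly support of an edge `e` w.r.t. an edge set `F`: the number of
butterflies of `F` one of whose four edges is `e`. -/
def btfSupport (F : Finset (V × V)) (e : V × V) : ℕ :=
  ((butterfliesIn F).filter fun P => e.1 ∈ P.1 ∧ e.2 ∈ P.2).card

/-- A priority on `G`: an injective integer labelling of the vertices of `G`
which is strictly monotone with respect to degrees. -/
def IsPriority (G : BipartiteGraph V) (p : V → ℤ) : Prop :=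
  Set.InjOn p ↑(G.U ∪ G.L) ∧
    ∀ x ∈ G.U ∪ G.L, ∀ y ∈ G.U ∪ G.L, G.deg y < G.deg x → p y < p x

/-- `(u, v, w)` is a wedge of `G`: `u ≠ w` lie in one layer and `v` lies in the
other layer, adjacent to both `u` and `w`. `u` is the start-vertex, `v` the
middle-vertex and `w` the end-vertex. -/
def IsWedge (G : BipartiteGraph V) (u v w : V) : Prop :=
  u ≠ w ∧ (((u, v) ∈ G.E ∧ (w, v) ∈ G.E) ∨ ((v, u) ∈ G.E ∧ (v, w) ∈ G.E))

/-- A priority-obeyed wedge: a wedge whose start-vertex has larger priority than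
both its middle-vertex and its end-vertex. -/
def IsPriorityWedge (G : BipartiteGraph V) (p : V → ℤ) (u v w : V) : Prop :=
  IsWedge G u v w ∧ p v < p u ∧ p w < p u

instance (G : BipartiteGraph V) (u v w : V) : Decidable (IsWedge G u v w) := by
  unfold IsWedge; infer_instance

instance (G : BipartiteGraph V) (p : V → ℤ) (u v w : V) :
    Decidable (IsPriorityWedge G p u v w) := by
  unfold IsPriorityWedge; infer_instance

namespace BipartiteGraph

theorem mem_nbrs (G : BipartiteGraph V) {x y : V} :
    y ∈ G.nbrs x ↔ (x, y) ∈ G.E ∨ (y, x) ∈ G.E := by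
  simp [nbrs]

end BipartiteGraph

/-- The degree is weakly monotone in the priority. -/
theorem IsPriority.deg_le {G : BipartiteGraph V} {p : V → ℤ} (hp : IsPriority G p) {x y : V}
    (hx : x ∈ G.U ∪ G.L) (hy : y ∈ G.U ∪ G.L) (hxy : p x ≤ p y) : G.deg x ≤ G.deg y :=
  not_lt.1 fun h => (hp.2 x hx y hy h).not_ge hxy

/-- The triples starting with the endpoints of `e`, the one of higher priority first, and
ending with a neighbor of the other. -/
def wedgeCandidates (G : BipartiteGraph V) (p : V → ℤ) (e : V × V) : Finset (V × V × V) :=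
  if p e.1 < p e.2 then (G.nbrs e.1).image fun w => (e.2, e.1, w)
  else (G.nbrs e.2).image fun w => (e.1, e.2, w)

theorem card_wedgeCandidates_le {G : BipartiteGraph V} {p : V → ℤ} (hp : IsPriority G p)
    {e : V × V} (he : e ∈ G.E) :
    (wedgeCandidates G p e).card ≤ min (G.deg e.1) (G.deg e.2) := by
  obtain ⟨h₁, h₂⟩ := G.mem_of_edge e he
  replace h₁ : e.1 ∈ G.U ∪ G.L := Finset.mem_union_left _ h₁
  replace h₂ : e.2 ∈ G.U ∪ G.L := Finset.mem_union_right _ h₂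
  unfold wedgeCandidates
  split_ifs with h
  · exact Finset.card_image_le.trans (le_min le_rfl (hp.deg_le h₁ h₂ h.le))
  · exact Finset.card_image_le.trans (le_min (hp.deg_le h₂ h₁ (not_lt.1 h)) le_rfl)

theorem IsPriorityWedge.exists_mem_wedgeCandidates {G : BipartiteGraph V} {p : V → ℤ}
    {u v w : V} (h : IsPriorityWedge G p u v w) :
    ∃ e ∈ G.E, (u, v, w) ∈ wedgeCandidates G p e := by
  obtain ⟨⟨-, ⟨huv, hwv⟩ | ⟨hvu, hvw⟩⟩, hlt, -⟩ := h
  · exact ⟨(u, v), huv, by simp [wedgeCandidates, hlt.not_gt, G.mem_nbrs, hwv]⟩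
  · exact ⟨(v, u), hvu, by simp [wedgeCandidates, hlt, G.mem_nbrs, hvw]⟩

/-- the total number of priority-obeyed wedges of `G` is at most
the sum over all edges `(u, v)` of `G` of `min (deg u) (deg v)`. -/
theorem total_priority_wedge_count (G : BipartiteGraph V) (p : V → ℤ)
    (hp : IsPriority G p) :
    (((G.U ∪ G.L) ×ˢ (G.U ∪ G.L) ×ˢ (G.U ∪ G.L)).filter
        (fun t => IsPriorityWedge G p t.1 t.2.1 t.2.2)).card ≤
      ∑ e ∈ G.E, min (G.deg e.1) (G.deg e.2) := by
  calc
    _ ≤ (G.E.biUnion (wedgeCandidates G p)).card := by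
      refine Finset.card_le_card fun t ht => Finset.mem_biUnion.2 ?_
      exact (Finset.mem_filter.1 ht).2.exists_mem_wedgeCandidates
    _ ≤ ∑ e ∈ G.E, (wedgeCandidates G p e).card := Finset.card_biUnion_le
    _ ≤ _ := Finset.sum_le_sum fun _ he => card_wedgeCandidates_le hp he
end

section
/- Given a bipartite graph G and a priority p on G, for every edge e ∈ E(G), the butterfly support ⋈_e equals the sum, over all maximal priority-obeyed blooms B of G whose edge set contains e, of (k_B − 1), where k_B denotes the bloom number of B. -/
variable {V : Type*} [DecidableEq V]

/-- The edge set of a bloom with dominant (two-vertex) layer `{a, b}` and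
other-layer vertex set `S`. If `flip = false` the dominant pair lies in the
upper layer; if `flip = true` it lies in the lower layer. -/
def bloomEdges (a b : V) (S : Finset V) (flip : Bool) : Finset (V × V) :=
  if flip then S.image (fun s => (s, a)) ∪ S.image (fun s => (s, b))
  else S.image (fun s => (a, s)) ∪ S.image (fun s => (b, s))

/-- A bloom of `G`: a `(2, k)`-biclique with `k = S.card ≥ 1`, consisting of a
pair of distinct vertices `{a, b}` in one layer both adjacent to every vertex of
the set `S` of the other layer. -/
structure Bloom (G : BipartiteGraph V) where
  a : V
  b : V
  S : Finset V
  flip : Bool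
  ne : a ≠ b
  nonempty : S.Nonempty
  sub : bloomEdges a b S flip ⊆ G.E

/-- The edge set of a bloom. -/
def Bloom.edges {G : BipartiteGraph V} (B : Bloom G) : Finset (V × V) :=
  bloomEdges B.a B.b B.S B.flip

/-- A bloom is priority-obeyed if its vertex with the largest priority lies in
the dominant (two-vertex) layer. -/
def Bloom.PriorityObeyed {G : BipartiteGraph V} (B : Bloom G) (p : V → ℤ) : Prop :=
  ∀ s ∈ B.S, p s < max (p B.a) (p B.b)

/-- A maximal priority-obeyed bloom: a priority-obeyed bloom such that no bloom
whose edge set properly contains its edge set is also priority-obeyed. -/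
def Bloom.IsMaxPriorityObeyed {G : BipartiteGraph V} (B : Bloom G) (p : V → ℤ) : Prop :=
  B.PriorityObeyed p ∧ ∀ B' : Bloom G, B'.PriorityObeyed p → ¬ B.edges ⊂ B'.edges

theorem bloomEdges_eq_product (a b : V) (S : Finset V) (flip : Bool) :
    bloomEdges a b S flip = if flip then S ×ˢ {a, b} else {a, b} ×ˢ S := by
  ext ⟨x, y⟩
  cases flip <;> simp [bloomEdges] <;> grind

theorem mem_butterfliesIn {F : Finset (V × V)} {P : Finset V × Finset V} :
    P ∈ butterfliesIn F ↔ P.1.card = 2 ∧ P.2.card = 2 ∧ P.1 ×ˢ P.2 ⊆ F := by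
  obtain ⟨A, C⟩ := P
  simp only [butterfliesIn, Finset.mem_filter, Finset.mem_product, Finset.mem_powersetCard]
  constructor
  · rintro ⟨⟨⟨-, hA⟩, -, hC⟩, h⟩
    refine ⟨hA, hC, fun x hx => ?_⟩
    rw [Finset.mem_product] at hx
    exact h _ hx.1 _ hx.2
  · rintro ⟨hA, hC, h⟩
    have h' : ∀ a ∈ A, ∀ c ∈ C, (a, c) ∈ F := fun a ha c hc => h (Finset.mk_mem_product ha hc)
    obtain ⟨a, ha⟩ : A.Nonempty := Finset.card_pos.1 (by omega)
    obtain ⟨c, hc⟩ : C.Nonempty := Finset.card_pos.1 (by omega)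
    exact ⟨⟨⟨fun x hx => Finset.mem_image.2 ⟨_, h' x hx c hc, rfl⟩, hA⟩,
      fun x hx => Finset.mem_image.2 ⟨_, h' a ha x hx, rfl⟩, hC⟩, h'⟩

/-- The butterfly support of an edge of a biclique. -/
theorem btfSupport_product {A C : Finset V} {e : V × V} (he : e ∈ A ×ˢ C) :
    btfSupport (A ×ˢ C) e = (A.card - 1) * (C.card - 1) := by
  obtain ⟨u, v⟩ := e
  rw [Finset.mem_product] at he
  obtain ⟨hu, hv⟩ := he
  simp only at hu hv
  rw [← Finset.card_erase_of_mem hu, ← Finset.card_erase_of_mem hv, ← Finset.card_product,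
    btfSupport]
  symm
  apply Finset.card_bij (fun x _ => (({u, x.1} : Finset V), ({v, x.2} : Finset V)))
  · rintro ⟨x, y⟩ h
    simp only [Finset.mem_product, Finset.mem_erase] at h
    simp only [Finset.mem_filter, mem_butterfliesIn]
    refine ⟨⟨Finset.card_pair h.1.1.symm, Finset.card_pair h.2.1.symm,
      Finset.product_subset_product ?_ ?_⟩, by simp, by simp⟩ <;> grind
  · rintro ⟨x, y⟩ h ⟨x', y'⟩ h' heq
    simp only [Finset.mem_product, Finset.mem_erase] at h h'
    simp only [Prod.mk.injEq, Finset.ext_iff, Finset.mem_insert, Finset.mem_singleton] at heq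
    have := heq.1 x
    have := heq.2 y
    grind
  · rintro ⟨X, Y⟩ h
    simp only [Finset.mem_filter, mem_butterfliesIn] at h
    obtain ⟨⟨hX, hY, hsub⟩, huX, hvY⟩ := h
    obtain ⟨x, hx⟩ := Finset.card_eq_one.1
      (show (X.erase u).card = 1 by rw [Finset.card_erase_of_mem huX, hX])
    obtain ⟨y, hy⟩ := Finset.card_eq_one.1
      (show (Y.erase v).card = 1 by rw [Finset.card_erase_of_mem hvY, hY])
    have hx' : x ∈ X.erase u := by simp [hx]
    have hy' : y ∈ Y.erase v := by simp [hy]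
    rw [Finset.mem_erase] at hx' hy'
    have hxy := Finset.mem_product.1 (hsub (Finset.mk_mem_product hx'.2 hy'.2))
    refine ⟨(x, y), ?_, ?_⟩
    · simp only [Finset.mem_product, Finset.mem_erase]
      exact ⟨⟨hx'.1, hxy.1⟩, hy'.1, hxy.2⟩
    · simp only [← hx, ← hy, Finset.insert_erase huX, Finset.insert_erase hvY]

theorem Bloom.btfSupport_edges {G : BipartiteGraph V} (B : Bloom G) {e : V × V}
    (he : e ∈ B.edges) : btfSupport B.edges e = B.edges.card / 2 - 1 := by
  have h2 : ({B.a, B.b} : Finset V).card = 2 := Finset.card_pair B.ne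
  rw [Bloom.edges, bloomEdges_eq_product] at he ⊢
  split_ifs at he ⊢ <;>
    rw [btfSupport_product he, Finset.card_product, h2] <;> omega

/-- The largest priority of the pair `{a, b}` strictly dominates `S` exactly when one of the two
vertices does. -/
theorem forall_lt_max_iff (p : V → ℤ) (a b : V) (S : Finset V) :
    (∀ s ∈ S, p s < max (p a) (p b)) ↔ ∃ m ∈ ({a, b} : Finset V), ∀ s ∈ S, p s < p m := by
  simp only [Finset.mem_insert, Finset.mem_singleton, exists_eq_or_imp, exists_eq_left]
  constructor
  · intro h
    rcases max_choice (p a) (p b) with h' | h' <;> rw [h'] at h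
    exacts [Or.inl h, Or.inr h]
  · rintro (h | h) s hs
    exacts [lt_max_of_lt_left (h s hs), lt_max_of_lt_right (h s hs)]

/-- A priority-obeyed bloom containing a priority-obeyed butterfly has the same dominant pair. -/
theorem eq_of_bloomEdges_subset {p : V → ℤ} {a b c d : V} {S T : Finset V} {f g : Bool}
    (hab : a ≠ b) (hT : T.card = 2) (hp : ∀ s ∈ T, p s < max (p a) (p b))
    (hq : ∀ s ∈ S, p s < max (p c) (p d))
    (h : bloomEdges a b T f ⊆ bloomEdges c d S g) :
    f = g ∧ ({a, b} : Finset V) = {c, d} := by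
  rw [forall_lt_max_iff] at hp hq
  obtain ⟨m, hm, hmT⟩ := hp
  obtain ⟨n, hn, hnS⟩ := hq
  have h2 : ({a, b} : Finset V).card = 2 := Finset.card_pair hab
  have hTne : T.Nonempty := Finset.card_pos.1 (by omega)
  have hne : ({a, b} : Finset V).Nonempty := by simp
  have hcd : ({c, d} : Finset V).card ≤ 2 := Finset.card_le_two
  have factors : ∀ {A B C D : Finset V}, A.Nonempty → B.Nonempty → A ×ˢ B ⊆ C ×ˢ D →
      A ⊆ C ∧ B ⊆ D := by
    rintro A B C D ⟨x, hx⟩ ⟨y, hy⟩ hs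
    exact ⟨fun z hz => (Finset.mem_product.1 (hs (Finset.mk_mem_product hz hy))).1,
      fun z hz => (Finset.mem_product.1 (hs (Finset.mk_mem_product hx hz))).2⟩
  have mixed : {a, b} ⊆ S → T ⊆ {c, d} → False := by
    intro h₁ h₂
    have hTe : T = {c, d} := Finset.eq_of_subset_of_card_le h₂ (by omega)
    exact lt_asymm (hmT n (hTe ▸ hn)) (hnS m (h₁ hm))
  rw [bloomEdges_eq_product, bloomEdges_eq_product] at h
  cases f <;> cases g <;> simp only [Bool.false_eq_true, if_true, if_false] at h
  · exact ⟨rfl, Finset.eq_of_subset_of_card_le (factors hne hTne h).1 (by omega)⟩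
  · exact (mixed (factors hne hTne h).1 (factors hne hTne h).2).elim
  · exact (mixed (factors hTne hne h).2 (factors hTne hne h).1).elim
  · exact ⟨rfl, Finset.eq_of_subset_of_card_le (factors hTne hne h).2 (by omega)⟩

theorem mem_bloomEdges {a b : V} {S : Finset V} {flip : Bool} {x : V × V} :
    x ∈ bloomEdges a b S flip ↔ ∃ s ∈ S, x ∈ bloomEdges a b {s} flip := by
  obtain ⟨x, y⟩ := x
  cases flip <;> simp [bloomEdges_eq_product] <;> grind

/-- Among the priority-obeyed blooms containing a priority-obeyed butterfly there is one that
contains all the others. -/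
theorem exists_greatest_bloom {G : BipartiteGraph V} {p : V → ℤ} {a b : V} {T : Finset V}
    {f : Bool} (hab : a ≠ b) (hT : T.card = 2) (hp : ∀ s ∈ T, p s < max (p a) (p b))
    (hsub : bloomEdges a b T f ⊆ G.E) :
    ∃ B : Bloom G, B.PriorityObeyed p ∧ bloomEdges a b T f ⊆ B.edges ∧
      ∀ B' : Bloom G, B'.PriorityObeyed p → bloomEdges a b T f ⊆ B'.edges →
        B'.edges ⊆ B.edges := by
  classical
  let S : Finset V := (G.E.image Prod.fst ∪ G.E.image Prod.snd).filter
    fun s => bloomEdges a b {s} f ⊆ G.E ∧ p s < max (p a) (p b)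
  have hS : ∀ s, s ∈ S ↔ bloomEdges a b {s} f ⊆ G.E ∧ p s < max (p a) (p b) := by
    intro s
    simp only [S, Finset.mem_filter, and_iff_right_iff_imp, Finset.mem_union, Finset.mem_image]
    rintro ⟨h, -⟩
    rw [bloomEdges_eq_product] at h
    cases f
    · exact Or.inr ⟨(a, s), h (by simp), rfl⟩
    · exact Or.inl ⟨(s, a), h (by simp), rfl⟩
  have hTS : T ⊆ S := fun s hs =>
    (hS s).2 ⟨fun x hx => hsub (mem_bloomEdges.2 ⟨s, hs, hx⟩), hp s hs⟩
  refine ⟨⟨a, b, S, f, hab, (Finset.card_pos.1 (by omega : 0 < T.card)).mono hTS, ?_⟩, ?_, ?_, ?_⟩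
  · intro x hx
    obtain ⟨s, hs, hx⟩ := mem_bloomEdges.1 hx
    exact ((hS s).1 hs).1 hx
  · exact fun s hs => ((hS s).1 hs).2
  · intro x hx
    obtain ⟨s, hs, hx⟩ := mem_bloomEdges.1 hx
    exact mem_bloomEdges.2 ⟨s, hTS hs, hx⟩
  · rintro ⟨c, d, S', g, hcd, hne, hsub'⟩ hob hle
    obtain ⟨rfl, hpair⟩ := eq_of_bloomEdges_subset hab hT hp hob hle
    have hswap : ∀ R, bloomEdges c d R f = bloomEdges a b R f := fun R => by
      rw [bloomEdges_eq_product, bloomEdges_eq_product, hpair]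
    intro x hx
    obtain ⟨s, hs, hx⟩ := mem_bloomEdges.1 hx
    refine mem_bloomEdges.2 ⟨s, (hS s).2 ⟨fun y hy => ?_, ?_⟩, hswap _ ▸ hx⟩
    · exact hsub' (mem_bloomEdges.2 ⟨s, hs, (hswap {s}).symm ▸ hy⟩)
    · have h := (forall_lt_max_iff p c d S').1 hob
      rw [← hpair] at h
      exact (forall_lt_max_iff p a b S').2 h s hs

/-- Every butterfly is a priority-obeyed bloom. -/
theorem exists_bloomEdges_of_butterfly {G : BipartiteGraph V} {p : V → ℤ}
    (hp : IsPriority G p) {P : Finset V × Finset V} (hP : P ∈ butterfliesIn G.E) :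
    ∃ (a b : V) (T : Finset V) (f : Bool), a ≠ b ∧ T.card = 2 ∧
      (∀ s ∈ T, p s < max (p a) (p b)) ∧ bloomEdges a b T f = P.1 ×ˢ P.2 := by
  obtain ⟨A, C⟩ := P
  obtain ⟨hA, hC, hsub⟩ := mem_butterfliesIn.1 hP
  simp only at hA hC hsub
  have hAne : A.Nonempty := Finset.card_pos.1 (by omega)
  have hCne : C.Nonempty := Finset.card_pos.1 (by omega)
  obtain ⟨m, hm, hmax⟩ := A.exists_max_image p hAne
  obtain ⟨n, hn, hnax⟩ := C.exists_max_image p hCne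
  obtain ⟨hmU, hnL⟩ := G.mem_of_edge _ (hsub (Finset.mk_mem_product hm hn))
  have hmn : p m ≠ p n := fun h => by
    have : m = n := hp.1 (by simp [hmU]) (by simp [hnL]) h
    exact Finset.disjoint_left.1 G.disj hmU (this ▸ hnL)
  obtain ⟨a, b, hab, rfl⟩ := Finset.card_eq_two.1 hA
  obtain ⟨c, d, hcd, rfl⟩ := Finset.card_eq_two.1 hC
  rcases lt_or_gt_of_ne hmn with h | h
  · exact ⟨c, d, {a, b}, true, hcd, hA,
      (forall_lt_max_iff ..).2 ⟨n, hn, fun s hs => (hmax s hs).trans_lt h⟩,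
      by simp [bloomEdges_eq_product]⟩
  · exact ⟨a, b, {c, d}, false, hab, hC,
      (forall_lt_max_iff ..).2 ⟨m, hm, fun s hs => (hnax s hs).trans_lt h⟩,
      by simp [bloomEdges_eq_product]⟩

/-- Every butterfly lies in exactly one maximal priority-obeyed bloom. -/
theorem existsUnique_max_bloom {G : BipartiteGraph V} {p : V → ℤ}
    (hp : IsPriority G p) {P : Finset V × Finset V} (hP : P ∈ butterfliesIn G.E) :
    ∃! F : Finset (V × V),
      (∃ B : Bloom G, B.IsMaxPriorityObeyed p ∧ B.edges = F) ∧ P.1 ×ˢ P.2 ⊆ F := by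
  obtain ⟨a, b, T, f, hab, hT, hob, heq⟩ := exists_bloomEdges_of_butterfly hp hP
  have hsub := (mem_butterfliesIn.1 hP).2.2
  rw [← heq] at hsub ⊢
  obtain ⟨B, hB, hTB, hgreatest⟩ := exists_greatest_bloom hab hT hob hsub
  refine ⟨B.edges, ⟨⟨B, ⟨hB, fun B' hB' hlt => ?_⟩, rfl⟩, hTB⟩, ?_⟩
  · exact hlt.2 (hgreatest B' hB' (hTB.trans hlt.1))
  · rintro _ ⟨⟨B', hB', rfl⟩, hT'⟩
    have hle := hgreatest B' hB'.1 hT'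
    by_contra hne
    exact hB'.2 B hB (hle.ssubset_of_ne hne)

open scoped Classical

/-- for every edge `e` of `G`, the butterfly support of `e`
equals the sum, over all (edge sets of) maximal priority-obeyed blooms `B` of
`G` containing `e`, of `k_B - 1`, where the bloom number `k_B` of a bloom with
edge set `F` is `F.card / 2`. -/
theorem support_eq_sum_over_max_blooms (G : BipartiteGraph V) (p : V → ℤ)
    (hp : IsPriority G p) (e : V × V) (he : e ∈ G.E) :
    btfSupport G.E e =
      ∑ F ∈ G.E.powerset.filter
          (fun F => (∃ B : Bloom G, B.IsMaxPriorityObeyed p ∧ B.edges = F) ∧ e ∈ F),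
        (F.card / 2 - 1) := by
  have hbtf : (butterfliesIn G.E).filter (fun P => e.1 ∈ P.1 ∧ e.2 ∈ P.2) =
      (G.E.powerset.filter
          (fun F => (∃ B : Bloom G, B.IsMaxPriorityObeyed p ∧ B.edges = F) ∧ e ∈ F)).biUnion
        fun F => (butterfliesIn F).filter fun P => e.1 ∈ P.1 ∧ e.2 ∈ P.2 := by
    ext P
    simp only [Finset.mem_biUnion, Finset.mem_filter, Finset.mem_powerset]
    constructor
    · rintro ⟨hP, he₁, he₂⟩
      obtain ⟨F, ⟨⟨B, hB, rfl⟩, hPF⟩, -⟩ := existsUnique_max_bloom hp hP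
      obtain ⟨hA, hC, -⟩ := mem_butterfliesIn.1 hP
      exact ⟨B.edges, ⟨B.sub, ⟨B, hB, rfl⟩, hPF (Finset.mem_product.2 ⟨he₁, he₂⟩)⟩,
        mem_butterfliesIn.2 ⟨hA, hC, hPF⟩, he₁, he₂⟩
    · rintro ⟨F, ⟨hF, -⟩, hP, he'⟩
      obtain ⟨hA, hC, hPF⟩ := mem_butterfliesIn.1 hP
      exact ⟨mem_butterfliesIn.2 ⟨hA, hC, hPF.trans hF⟩, he'⟩
  rw [btfSupport, hbtf, Finset.card_biUnion]
  · refine Finset.sum_congr rfl fun F hF => ?_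
    obtain ⟨-, ⟨B, -, rfl⟩, heB⟩ := Finset.mem_filter.1 hF
    exact B.btfSupport_edges heB
  · intro F hF F' hF' hne
    rw [Function.onFun, Finset.disjoint_left]
    intro P hP hP'
    obtain ⟨hA, hC, hPF⟩ := mem_butterfliesIn.1 (Finset.mem_filter.1 hP).1
    have hPF' := (mem_butterfliesIn.1 (Finset.mem_filter.1 hP').1).2.2
    obtain ⟨hFE, hF, -⟩ := Finset.mem_filter.1 hF
    obtain ⟨-, hF', -⟩ := Finset.mem_filter.1 hF'
    have hPE : P ∈ butterfliesIn G.E :=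
      mem_butterfliesIn.2 ⟨hA, hC, hPF.trans (Finset.mem_powerset.1 hFE)⟩
    exact hne ((existsUnique_max_bloom hp hPE).unique ⟨hF, hPF⟩ ⟨hF', hPF'⟩)
end
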